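/- arXiv:1908.07929 — 4 statements merged into one kernel-verified Lean document; each statement's English description precedes it below -/
import Mathlib

section
/- Let n ≥ 1 and let k be a field whose characteristic is either 0 or greater than 2n+1. Let g be a (2n+1)×(2n+1) matrix over k satisfying g² = 1, gᵀ g = 1, and tr g = 1. Then the k-subspace { X ∈ M_{2n+1}(k) : Xᵀ = −X and g X = X g } of matrices in the Lie algebra 𝔰𝔬_{2n+1} fixed by conjugation by g has dimension n². -/
open Matrix

noncomputable section

/-- The subspace of skew-symmetric `m × m` matrices commuting with `g`, i.e. the fixed
points of the adjoint action of `g` on the Lie algebra `𝔰𝔬_m`. -/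
def fixedSkewSubmodule (k : Type*) [Field k] (m : ℕ) (g : Matrix (Fin m) (Fin m) k) :
    Submodule k (Matrix (Fin m) (Fin m) k) where
  carrier := {X | Xᵀ = -X ∧ g * X = X * g}
  add_mem' := by
    rintro a b ⟨ha1, ha2⟩ ⟨hb1, hb2⟩
    exact ⟨by rw [transpose_add, ha1, hb1, neg_add],
      by rw [Matrix.mul_add, ha2, hb2, Matrix.add_mul]⟩
  zero_mem' := by simp
  smul_mem' := by
    rintro c a ⟨ha1, ha2⟩
    exact ⟨by rw [transpose_smul, ha1, smul_neg],
      by rw [Matrix.mul_smul, ha2, Matrix.smul_mul]⟩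

/-- An involution over a field of characteristic not two is diagonalizable, with
eigenvalues `1` (at the indices in `A`) and `-1` (at the others). -/
theorem exists_diagonalization_of_involution {k : Type*} [Field k] (h2 : (2 : k) ≠ 0) {m : ℕ}
    (g : Matrix (Fin m) (Fin m) k) (hg : g * g = 1) :
    ∃ (T S : Matrix (Fin m) (Fin m) k) (A : Finset (Fin m)), T * S = 1 ∧ S * T = 1 ∧
      g = T * diagonal (fun i => if i ∈ A then 1 else -1) * S := by
  classical
  let s : Set (Fin m → k) := {v | g *ᵥ v = v ∨ g *ᵥ v = -v}
  have hs : ⊤ ≤ Submodule.span k s := by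
    intro v _
    have hgg : g *ᵥ (g *ᵥ v) = v := by rw [mulVec_mulVec, hg, one_mulVec]
    have hv : v = (2 : k)⁻¹ • ((v + g *ᵥ v) + (v - g *ᵥ v)) := by
      rw [add_add_sub_cancel, ← two_smul k v, smul_smul, inv_mul_cancel₀ h2, one_smul]
    rw [hv]
    refine Submodule.smul_mem _ _ (Submodule.add_mem _ (Submodule.subset_span (Or.inl ?_))
      (Submodule.subset_span (Or.inr ?_)))
    · rw [mulVec_add, hgg, add_comm]
    · rw [mulVec_sub, hgg, neg_sub]
  let b₀ := Module.Basis.ofSpan hs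
  let b := b₀.reindex (b₀.indexEquiv (Pi.basisFun k (Fin m)))
  have hb : ∀ j, b j ∈ s := by
    intro j
    apply Module.Basis.ofSpan_subset hs
    rw [Module.Basis.reindex_apply]
    exact Set.mem_range_self _
  let T := (Pi.basisFun k (Fin m)).toMatrix b
  let S := b.toMatrix (Pi.basisFun k (Fin m))
  have hTS : T * S = 1 := Module.Basis.toMatrix_mul_toMatrix_flip _ _
  refine ⟨T, S, Finset.univ.filter (fun j => g *ᵥ b j = b j), hTS,
    Module.Basis.toMatrix_mul_toMatrix_flip _ _, ?_⟩
  have hgT : g * T =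
      T * diagonal (fun i => if i ∈ Finset.univ.filter (fun j => g *ᵥ b j = b j)
        then 1 else -1) := by
    ext i j
    have hij : (g * T) i j = (g *ᵥ b j) i := by
      simp [T, Matrix.mul_apply, mulVec, dotProduct, Module.Basis.toMatrix_apply]
    rw [hij, mul_diagonal]
    by_cases h : g *ᵥ b j = b j
    · simp [h, T, Module.Basis.toMatrix_apply]
    · simp [(hb j).resolve_left h, (hb j).resolve_left h ▸ h, T, Module.Basis.toMatrix_apply]
  rw [← hgT, Matrix.mul_assoc, hTS, Matrix.mul_one]

/-- Congruence by `S`, with inverse `T`, identifies the skew-symmetric matrices commuting with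
the symmetric matrix `T * D * S` with those commuting with the symmetric matrix `D`. -/
def fixedSkewCongr {k : Type*} [Field k] {m : ℕ} (T S g D : Matrix (Fin m) (Fin m) k)
    (hTS : T * S = 1) (hST : S * T = 1) (hg : g = T * D * S) (hgt : gᵀ = g) (hD : Dᵀ = D) :
    fixedSkewSubmodule k m g ≃ₗ[k] fixedSkewSubmodule k m D where
  toFun X := ⟨S * X.1 * Sᵀ, by
    obtain ⟨X, hX, hgX⟩ := X
    refine ⟨by simp [transpose_mul, hX, Matrix.mul_assoc], ?_⟩
    have hSg : S * g = D * S := by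
      rw [hg, ← Matrix.mul_assoc, ← Matrix.mul_assoc, hST, Matrix.one_mul]
    have hgS : g * Sᵀ = Sᵀ * D := by
      simpa [transpose_mul, hgt, hD] using congrArg transpose hSg
    calc D * (S * X * Sᵀ) = S * (g * X) * Sᵀ := by
          simp only [← Matrix.mul_assoc, hSg]
      _ = S * X * Sᵀ * D := by simp only [hgX, Matrix.mul_assoc, hgS]⟩
  invFun Y := ⟨T * Y.1 * Tᵀ, by
    obtain ⟨Y, hY, hDY⟩ := Y
    refine ⟨by simp [transpose_mul, hY, Matrix.mul_assoc], ?_⟩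
    have hgT : g * T = T * D := by
      rw [hg, Matrix.mul_assoc, hST, Matrix.mul_one]
    have hTg : Tᵀ * g = D * Tᵀ := by
      simpa [transpose_mul, hgt, hD] using congrArg transpose hgT
    calc g * (T * Y * Tᵀ) = T * (D * Y) * Tᵀ := by
          simp only [← Matrix.mul_assoc, hgT]
      _ = T * Y * Tᵀ * g := by simp only [hDY, Matrix.mul_assoc, hTg]⟩
  map_add' X Y := by ext1; simp [Matrix.mul_add, Matrix.add_mul]
  map_smul' c X := by ext1; simp
  left_inv X := by
    ext1
    have h : Sᵀ * Tᵀ = 1 := by rw [← transpose_mul, hTS, transpose_one]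
    calc T * (S * X.1 * Sᵀ) * Tᵀ = (T * S) * X.1 * (Sᵀ * Tᵀ) := by
          simp only [Matrix.mul_assoc]
      _ = X.1 := by rw [hTS, h, Matrix.one_mul, Matrix.mul_one]
  right_inv Y := by
    ext1
    have h : Tᵀ * Sᵀ = 1 := by rw [← transpose_mul, hST, transpose_one]
    calc S * (T * Y.1 * Tᵀ) * Sᵀ = (S * T) * Y.1 * (Tᵀ * Sᵀ) := by
          simp only [Matrix.mul_assoc]
      _ = Y.1 := by rw [hST, h, Matrix.one_mul, Matrix.mul_one]

/-- Skew-symmetric matrices commuting with a diagonal matrix of signs are determined by the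
entries above the diagonal at the positions where the two signs agree. -/
def fixedSkewDiagonalEquiv {k : Type*} [Field k] (h2 : (2 : k) ≠ 0) {m : ℕ}
    (A : Finset (Fin m)) :
    fixedSkewSubmodule k m (diagonal fun i => if i ∈ A then 1 else -1) ≃ₗ[k]
      ({p : Fin m × Fin m // p.1 < p.2 ∧ (p.1 ∈ A ↔ p.2 ∈ A)} → k) where
  toFun Y p := Y.1 p.1.1 p.1.2
  invFun f := ⟨Matrix.of fun i j =>
      if h : i < j ∧ (i ∈ A ↔ j ∈ A) then f ⟨(i, j), h⟩
      else if h : j < i ∧ (j ∈ A ↔ i ∈ A) then -f ⟨(j, i), h⟩ else 0, by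
    refine ⟨?_, ?_⟩
    · ext i j
      simp only [transpose_apply, of_apply, Matrix.neg_apply]
      split_ifs with h₁ h₂ h₂
      · exact absurd h₁.1 h₂.1.not_gt
      all_goals simp
    · ext i j
      rw [diagonal_mul, mul_diagonal]
      simp only [of_apply]
      by_cases hi : i ∈ A <;> by_cases hj : j ∈ A <;> simp [hi, hj]
      split_ifs <;> simp⟩
  map_add' X Y := rfl
  map_smul' c X := rfl
  left_inv Y := by
    obtain ⟨Y, hY, hDY⟩ := Y
    ext i j
    have hskew : ∀ i j, Y j i = -Y i j := fun i j => congrFun (congrFun hY i) j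
    have hcomm := congrFun (congrFun hDY i) j
    rw [diagonal_mul, mul_diagonal] at hcomm
    have hzero : ∀ x : k, x = -x → x = 0 := fun x hx => by
      have : 2 * x = 0 := by linear_combination hx
      exact (mul_eq_zero.mp this).resolve_left h2
    simp only [of_apply]
    split_ifs with h₁ h₃
    · rfl
    · rw [hskew i j, neg_neg]
    · symm
      rcases lt_trichotomy i j with hij | rfl | hij
      · by_cases hi : i ∈ A <;> by_cases hj : j ∈ A <;> simp [hi, hj, hij] at h₁ hcomm
        · exact hzero _ hcomm
        · exact hzero _ hcomm.symm
      · exact hzero _ (hskew i i)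
      · by_cases hi : i ∈ A <;> by_cases hj : j ∈ A <;> simp [hi, hj, hij] at h₃ hcomm
        · exact hzero _ hcomm
        · exact hzero _ hcomm.symm
  right_inv f := by
    ext p
    simp [p.2]

/-- Twice the number of increasing pairs lying on the same side of `A`, plus the number of
diagonal pairs, is the number of all pairs lying on the same side of `A`. -/
theorem two_mul_card_lt_pairs_add {m : ℕ} (A : Finset (Fin m)) :
    2 * Fintype.card {p : Fin m × Fin m // p.1 < p.2 ∧ (p.1 ∈ A ↔ p.2 ∈ A)} + m =
      A.card ^ 2 + (Aᶜ).card ^ 2 := by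
  classical
  let U : Finset (Fin m × Fin m) := {p | p.1 < p.2 ∧ (p.1 ∈ A ↔ p.2 ∈ A)}
  let L : Finset (Fin m × Fin m) := {p | p.2 < p.1 ∧ (p.1 ∈ A ↔ p.2 ∈ A)}
  have hUL : L.card = U.card :=
    Finset.card_bij (fun p _ => p.swap) (by simp +contextual [U, L])
      (fun a _ b _ h => Prod.swap_injective h)
      (fun b hb => ⟨b.swap, by simp_all [U, L], by simp⟩)
  have hcup : (U ∪ L) ∪ Finset.univ.diag = A ×ˢ A ∪ Aᶜ ×ˢ Aᶜ := by
    ext ⟨i, j⟩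
    simp only [U, L, Finset.mem_union, Finset.mem_filter, Finset.mem_univ, true_and,
      Finset.mem_diag, Finset.mem_product, Finset.mem_compl]
    rcases lt_trichotomy i j with h | rfl | h
    · simp only [h, h.not_gt, h.ne]; tauto
    · simp only [lt_irrefl]; tauto
    · simp only [h, h.not_gt, h.ne']; tauto
  have hdUL : Disjoint U L := by
    rw [Finset.disjoint_left]
    rintro p hp hq
    simp only [U, L, Finset.mem_filter] at hp hq
    exact hp.2.1.not_gt hq.2.1
  have hd : Disjoint (U ∪ L) Finset.univ.diag := by
    rw [Finset.disjoint_left]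
    rintro p hp hq
    simp only [U, L, Finset.mem_union, Finset.mem_filter, Finset.mem_diag] at hp hq
    rcases hp with hp | hp
    · exact hp.2.1.ne hq.2
    · exact hp.2.1.ne' hq.2
  have hdA : Disjoint (A ×ˢ A) (Aᶜ ×ˢ Aᶜ) :=
    Finset.disjoint_product.mpr (Or.inl disjoint_compl_right)
  have hcard := congrArg Finset.card hcup
  rw [Finset.card_union_of_disjoint hd, Finset.card_union_of_disjoint hdUL,
    Finset.card_union_of_disjoint hdA, hUL, Finset.diag_card, Finset.card_product,
    Finset.card_product, Finset.card_univ, Fintype.card_fin] at hcard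
  rw [Fintype.card_subtype]
  change 2 * U.card + m = _
  linarith

/-- Small natural numbers are determined by their images in a field of large characteristic. -/
theorem natCast_inj_of_le_of_lt_ringChar {k : Type*} [Field k] {N a b : ℕ}
    (hchar : ringChar k = 0 ∨ N < ringChar k) (ha : a ≤ N) (hb : b ≤ N)
    (h : (a : k) = b) : a = b := by
  rw [CharP.natCast_eq_natCast k (ringChar k)] at h
  rcases hchar with h0 | hlt
  · rwa [h0, Nat.modEq_zero_iff] at h
  · exact h.eq_of_lt_of_lt (ha.trans_lt hlt) (hb.trans_lt hlt)

/-- If `g` is an orthogonal involution of trace `1` in odd dimension `2n+1`, over a field of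
characteristic `0` or `> 2n+1`, then the fixed subspace of the adjoint action of `g` on
`𝔰𝔬_{2n+1}` has dimension `n²`. -/
theorem finrank_fixedSkew (k : Type*) [Field k] (n : ℕ) (hn : 1 ≤ n)
    (hchar : ringChar k = 0 ∨ 2 * n + 1 < ringChar k)
    (g : Matrix (Fin (2 * n + 1)) (Fin (2 * n + 1)) k)
    (hg2 : g * g = 1) (hgo : gᵀ * g = 1) (hgt : Matrix.trace g = 1) :
    Module.finrank k (fixedSkewSubmodule k (2 * n + 1) g) = n ^ 2 := by
  have h2 : (2 : k) ≠ 0 := fun h => by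
    have := natCast_inj_of_le_of_lt_ringChar (k := k) (a := 2) (b := 0) hchar (by omega)
      (by omega) (by simpa using h)
    omega
  have hsymm : gᵀ = g := by
    rw [← Matrix.mul_one gᵀ, ← hg2, ← Matrix.mul_assoc, hgo, Matrix.one_mul]
  obtain ⟨T, S, A, hTS, hST, hg⟩ := exists_diagonalization_of_involution h2 g hg2
  have hcard : A.card + (Aᶜ).card = 2 * n + 1 := by simp [Finset.card_add_card_compl]
  have htr : (A.card : k) - (Aᶜ).card = 1 := by
    rw [← hgt, hg, trace_mul_comm, ← Matrix.mul_assoc, hST, Matrix.one_mul, trace_diagonal,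
      ← Finset.sum_add_sum_compl A, Finset.sum_congr rfl (g := fun _ => (1 : k)),
      Finset.sum_congr (s₁ := Aᶜ) rfl (g := fun _ => (-1 : k))]
    · simp [sub_eq_add_neg]
    · intro i hi
      rw [if_neg (Finset.mem_compl.mp hi)]
    · intro i hi
      rw [if_pos hi]
  have hA : A.card = n + 1 := by
    refine natCast_inj_of_le_of_lt_ringChar hchar (by omega) (by omega) (mul_left_cancel₀ h2 ?_)
    have hk : (A.card : k) + (Aᶜ).card = 2 * n + 1 := by
      simpa only [Nat.cast_add, Nat.cast_mul, Nat.cast_ofNat, Nat.cast_one]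
        using congrArg (Nat.cast : ℕ → k) hcard
    push_cast
    linear_combination htr + hk
  have hAc : (Aᶜ).card = n := by omega
  rw [((fixedSkewCongr T S g _ hTS hST hg hsymm (diagonal_transpose _)).trans
    (fixedSkewDiagonalEquiv h2 A)).finrank_eq, Module.finrank_fintype_fun_eq_card]
  have := two_mul_card_lt_pairs_add A
  rw [hA, hAc] at this
  linarith
end
end

section
/- Let n ≥ 1 and let k be a field of characteristic different from 2. Let J denote the 2n×2n block matrix [[0, I_n],[−I_n, 0]] over k. Suppose g is a 2n×2n matrix over k satisfying g² = 1 and gᵀ J g = −J. Then tr g = 0, and the k-subspace { X ∈ M_{2n}(k) : Xᵀ J + J X = 0 and g X = X g } of elements of the symplectic Lie algebra 𝔰𝔭_{2n} fixed by conjugation by g has dimension n². -/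
open Matrix

noncomputable section

/-- The standard symplectic form matrix `J = [[0, I_n], [−I_n, 0]]` in dimension `2n`. -/
def sympJ (k : Type*) [Field k] (n : ℕ) : Matrix (Fin n ⊕ Fin n) (Fin n ⊕ Fin n) k :=
  Matrix.fromBlocks (0 : Matrix (Fin n) (Fin n) k) 1 (-1) 0

/-- The subspace of elements of the symplectic Lie algebra `𝔰𝔭_{2n}` commuting with `g`,
i.e. the fixed points of the adjoint action of `g`. -/
def fixedSympSubmodule (k : Type*) [Field k] (n : ℕ)
    (g : Matrix (Fin n ⊕ Fin n) (Fin n ⊕ Fin n) k) :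
    Submodule k (Matrix (Fin n ⊕ Fin n) (Fin n ⊕ Fin n) k) where
  carrier := {X | Xᵀ * sympJ k n + sympJ k n * X = 0 ∧ g * X = X * g}
  add_mem' := by
    rintro a b ⟨ha1, ha2⟩ ⟨hb1, hb2⟩
    constructor
    · have h : (a + b)ᵀ * sympJ k n + sympJ k n * (a + b) =
          (aᵀ * sympJ k n + sympJ k n * a) + (bᵀ * sympJ k n + sympJ k n * b) := by
        rw [transpose_add, Matrix.add_mul, Matrix.mul_add]; abel
      rw [h, ha1, hb1, add_zero]
    · rw [Matrix.mul_add, ha2, hb2, Matrix.add_mul]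
  zero_mem' := by simp
  smul_mem' := by
    rintro c a ⟨ha1, ha2⟩
    constructor
    · rw [transpose_smul, Matrix.smul_mul, Matrix.mul_smul, ← smul_add, ha1, smul_zero]
    · rw [Matrix.mul_smul, ha2, Matrix.smul_mul]

/-- A square matrix that is idempotent of rank `r` factors as `A * B` through `k ^ r`,
with `B * A = 1`. -/
theorem exists_mul_eq_and_mul_eq_one_of_isIdempotentElem {k m : Type*} [Field k]
    [Fintype m] [DecidableEq m] {p : Matrix m m k} (hp : IsIdempotentElem p) :
    ∃ (A : Matrix m (Fin p.rank) k) (B : Matrix (Fin p.rank) m k), A * B = p ∧ B * A = 1 := by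
  obtain ⟨e⟩ : Nonempty (p.mulVecLin.range ≃ₗ[k] (Fin p.rank → k)) :=
    FiniteDimensional.nonempty_linearEquiv_of_finrank_eq (Module.finrank_fin_fun k).symm
  refine ⟨(p.mulVecLin.range.subtype ∘ₗ e.symm.toLinearMap).toMatrix',
    (e.toLinearMap ∘ₗ p.mulVecLin.rangeRestrict).toMatrix', ?_, ?_⟩
  · rw [← LinearMap.toMatrix'_comp]
    convert LinearMap.toMatrix'_toLin' p using 2
    refine LinearMap.ext fun x => ?_
    simp
  · rw [← LinearMap.toMatrix'_comp, ← LinearMap.toMatrix'_id]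
    congr 1
    refine LinearMap.ext fun x => ?_
    obtain ⟨y, hy⟩ := (e.symm x).2
    have h : p.mulVecLin.rangeRestrict (e.symm x : m → k) = e.symm x := by
      refine Subtype.ext ?_
      rw [← hy]
      simp [hp.eq]
    simp [h]

section

variable {k : Type*} [Field k] {n : ℕ}

theorem sympJ_mul_sympJ : sympJ k n * sympJ k n = -1 := by
  simp [sympJ, fromBlocks_multiply, ← fromBlocks_one, fromBlocks_neg]

theorem sympJ_transpose : (sympJ k n)ᵀ = -sympJ k n := by
  simp [sympJ, fromBlocks_transpose, fromBlocks_neg]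

theorem isUnit_sympJ : IsUnit (sympJ k n) :=
  IsUnit.of_mul_eq_one (-sympJ k n) (by simp [sympJ_mul_sympJ])

variable {g : Matrix (Fin n ⊕ Fin n) (Fin n ⊕ Fin n) k}

/-- Membership in `𝔰𝔭_{2n}` as being fixed by the anti-involution `X ↦ J Xᵀ J`. -/
theorem mem_fixedSympSubmodule_iff {X : Matrix (Fin n ⊕ Fin n) (Fin n ⊕ Fin n) k} :
    X ∈ fixedSympSubmodule k n g ↔ sympJ k n * Xᵀ * sympJ k n = X ∧ g * X = X * g := by
  refine and_congr_left fun _ => ?_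
  rw [← isUnit_sympJ.mul_right_inj, mul_add, ← mul_assoc, ← mul_assoc, sympJ_mul_sympJ, mul_zero,
    neg_one_mul, add_neg_eq_zero]

theorem transpose_mul_sympJ (hg2 : g * g = 1) (hgJ : gᵀ * sympJ k n * g = -sympJ k n) :
    gᵀ * sympJ k n = -(sympJ k n * g) := by
  rw [← neg_mul, ← hgJ, mul_assoc _ g g, hg2, mul_one]

theorem trace_eq_zero_of_transpose_mul_sympJ (hchar : (2 : k) ≠ 0)
    (h : gᵀ * sympJ k n = -(sympJ k n * g)) : g.trace = 0 := by
  have key : g.trace = -g.trace := by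
    have h2 := congrArg (fun M => (M * sympJ k n).trace) h
    simp only [mul_assoc, sympJ_mul_sympJ, neg_mul, trace_neg] at h2
    rw [trace_mul_comm (sympJ k n), mul_assoc, sympJ_mul_sympJ] at h2
    simpa only [mul_neg, mul_one, trace_neg, trace_transpose, neg_inj] using h2
  have : 2 * g.trace = 0 := by linear_combination key
  exact (mul_eq_zero.mp this).resolve_left hchar

/-- An idempotent whose symplectic adjoint is the complementary idempotent has rank `n`. -/
theorem rank_eq_of_transpose_mul_sympJ {p : Matrix (Fin n ⊕ Fin n) (Fin n ⊕ Fin n) k}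
    (hp : IsIdempotentElem p) (h : pᵀ * sympJ k n = sympJ k n * (1 - p)) : p.rank = n := by
  have hdet : IsUnit (sympJ k n).det := (isUnit_iff_isUnit_det _).mp isUnit_sympJ
  have hrank : p.rank = (1 - p).rank := by
    rw [← rank_transpose, ← rank_mul_eq_left_of_isUnit_det _ _ hdet, h,
      rank_mul_eq_right_of_isUnit_det _ _ hdet]
  have hle := rank_add_rank_le_card_of_mul_eq_zero (hp.mul_one_sub_self)
  have hge : (1 : Matrix (Fin n ⊕ Fin n) (Fin n ⊕ Fin n) k).rank ≤ p.rank + (1 - p).rank := by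
    have hsup : (p.mulVecLin + (1 - p).mulVecLin).range ≤
        p.mulVecLin.range ⊔ (1 - p).mulVecLin.range := LinearMap.range_add_le _ _
    rw [← mulVecLin_add, add_sub_cancel] at hsup
    exact (Submodule.finrank_mono hsup).trans (Submodule.finrank_add_le_finrank_add_finrank _ _)
  rw [rank_one] at hge
  simp only [Fintype.card_sum, Fintype.card_fin] at hge hle
  omega

/-- Sending `X` to its compression `B * X * A` identifies the subspace fixed by the involution
`2 p - 1`, where `p = A * B` is idempotent, with the endomorphisms of the image of `p`. -/
def fixedSympEquiv (hchar : (2 : k) ≠ 0)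
    {p : Matrix (Fin n ⊕ Fin n) (Fin n ⊕ Fin n) k} (hgp : g = (2 : k) • p - 1)
    (h : pᵀ * sympJ k n = sympJ k n * (1 - p)) {r : ℕ}
    {A : Matrix (Fin n ⊕ Fin n) (Fin r) k} {B : Matrix (Fin r) (Fin n ⊕ Fin n) k}
    (hAB : A * B = p) (hBA : B * A = 1) :
    fixedSympSubmodule k n g ≃ₗ[k] Matrix (Fin r) (Fin r) k :=
  have hcomm (X) : g * X = X * g ↔ p * X = X * p := by
    simp [hgp, sub_mul, mul_sub, smul_right_inj hchar]
  have hpA : p * A = A := by rw [← hAB, Matrix.mul_assoc, hBA, Matrix.mul_one]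
  have hBp : B * p = B := by rw [← hAB, ← Matrix.mul_assoc, hBA, Matrix.one_mul]
  have hpp : p * p = p := by
    nth_rw 2 [← hAB]
    rw [← Matrix.mul_assoc, hpA, hAB]
  have hJ : sympJ k n * pᵀ = (1 - p) * sympJ k n := by
    have h2 := congrArg (fun M => sympJ k n * M * sympJ k n) h
    rw [← neg_inj, ← neg_mul (1 - p), neg_sub]
    simpa [mul_assoc, sympJ_mul_sympJ, ← mul_assoc (sympJ k n) (sympJ k n)] using h2
  have hpJ : p * sympJ k n = sympJ k n * (1 - pᵀ) := by
    rw [mul_sub, hJ, sub_mul, mul_one, one_mul, sub_sub_cancel]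
  have hJp : sympJ k n * p = (1 - pᵀ) * sympJ k n := by
    rw [sub_mul, h, mul_sub, mul_one, one_mul, sub_sub_cancel]
  have hZ_left (Y : Matrix (Fin r) (Fin r) k) : p * (A * Y * B) = A * Y * B := by
    rw [← Matrix.mul_assoc, ← Matrix.mul_assoc, hpA]
  have hZ_right (Y : Matrix (Fin r) (Fin r) k) : A * Y * B * p = A * Y * B := by
    rw [Matrix.mul_assoc, hBp]
  have hadj_left (Y : Matrix (Fin r) (Fin r) k) :
      p * (sympJ k n * (A * Y * B)ᵀ * sympJ k n) = 0 := by
    rw [← mul_assoc, ← mul_assoc, hpJ, mul_assoc (sympJ k n), sub_mul, one_mul, ← transpose_mul,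
      hZ_right, sub_self, mul_zero, zero_mul]
  have hadj_right (Y : Matrix (Fin r) (Fin r) k) :
      sympJ k n * (A * Y * B)ᵀ * sympJ k n * p = 0 := by
    rw [mul_assoc, hJp, ← mul_assoc, mul_assoc (sympJ k n), mul_sub, mul_one, ← transpose_mul,
      hZ_left, sub_self, mul_zero, zero_mul]
  { toFun X := B * X.1 * A
    map_add' X Y := by simp [Matrix.mul_add, Matrix.add_mul]
    map_smul' c X := by simp
    invFun Y := ⟨A * Y * B + sympJ k n * (A * Y * B)ᵀ * sympJ k n, by
      refine mem_fixedSympSubmodule_iff.mpr ⟨?_, ?_⟩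
      · generalize A * Y * B = Z
        rw [transpose_add, transpose_mul, transpose_mul, transpose_transpose, sympJ_transpose,
          mul_add, add_mul, add_comm]
        congr 1
        simp [mul_assoc, sympJ_mul_sympJ, ← mul_assoc (sympJ k n) (sympJ k n)]
      · rw [hcomm, mul_add, add_mul, hZ_left, hZ_right, hadj_left, hadj_right]⟩
    left_inv X := by
      obtain ⟨X, hX⟩ := X
      obtain ⟨hX, hXg⟩ := mem_fixedSympSubmodule_iff.mp hX
      rw [hcomm] at hXg
      refine Subtype.ext ?_
      have hZ : A * (B * X * A) * B = p * X * p := by simp only [← hAB, Matrix.mul_assoc]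
      have hadj : sympJ k n * (p * X * p)ᵀ * sympJ k n = (1 - p) * X * (1 - p) := by
        calc sympJ k n * (p * X * p)ᵀ * sympJ k n
            = (sympJ k n * pᵀ) * Xᵀ * (pᵀ * sympJ k n) := by simp only [transpose_mul, mul_assoc]
          _ = (1 - p) * (sympJ k n * Xᵀ * sympJ k n) * (1 - p) := by
              rw [hJ, h]; simp only [mul_assoc]
          _ = (1 - p) * X * (1 - p) := by rw [hX]
      have hXp : p * X * p = X * p := by rw [hXg, mul_assoc, hpp]
      simp only [hZ, hadj]
      rw [mul_sub, mul_one, sub_mul, one_mul, sub_mul, hXp, hXg, sub_self, sub_zero]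
      abel
    right_inv Y := by
      have hB : B * (sympJ k n * (A * Y * B)ᵀ * sympJ k n) = 0 := by
        rw [← hBp, Matrix.mul_assoc, hBp, hadj_left, Matrix.mul_zero]
      simp only [Matrix.mul_add, hB, add_zero]
      rw [← Matrix.mul_assoc, ← Matrix.mul_assoc, hBA, Matrix.one_mul, Matrix.mul_assoc, hBA,
        Matrix.mul_one] }

end

/-- If `g ∈ GSp_{2n}(k)` is an involution with similitude factor `−1` (i.e. `gᵀ J g = −J`),
over a field of characteristic `≠ 2`, then `tr g = 0` and the fixed subspace of the adjoint
action of `g` on `𝔰𝔭_{2n}` has dimension `n²`. -/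
theorem trace_and_finrank_fixedSymp (k : Type*) [Field k] (hchar : (2 : k) ≠ 0)
    (n : ℕ) (hn : 1 ≤ n)
    (g : Matrix (Fin n ⊕ Fin n) (Fin n ⊕ Fin n) k)
    (hg2 : g * g = 1)
    (hgJ : gᵀ * sympJ k n * g = -sympJ k n) :
    Matrix.trace g = 0 ∧ Module.finrank k (fixedSympSubmodule k n g) = n ^ 2 := by
  have hadj := transpose_mul_sympJ hg2 hgJ
  refine ⟨trace_eq_zero_of_transpose_mul_sympJ hchar hadj, ?_⟩
  obtain ⟨p, hp⟩ : ∃ p, p = (2 : k)⁻¹ • (1 + g) := ⟨_, rfl⟩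
  have hgp : g = (2 : k) • p - 1 := by simp [hp, smul_smul, hchar]
  have hidem : IsIdempotentElem p := by
    have hsq : (1 + g) * (1 + g) = (2 : k) • (1 + g) := by
      rw [mul_add, add_mul, add_mul, hg2, two_smul]
      simp only [one_mul, mul_one]
      abel
    rw [IsIdempotentElem, hp, smul_mul_smul_comm, hsq, smul_smul, mul_assoc,
      inv_mul_cancel₀ hchar, mul_one]
  have hpJ : pᵀ * sympJ k n = sympJ k n * (1 - p) := by
    have hcompl : 1 - p = (2 : k)⁻¹ • (1 - g) := by
      rw [hp, eq_comm, eq_sub_iff_add_eq, ← smul_add, sub_add_add_cancel, ← two_smul k, smul_smul,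
        inv_mul_cancel₀ hchar, one_smul]
    rw [hcompl, hp, transpose_smul, smul_mul_assoc, mul_smul_comm, transpose_add, transpose_one,
      add_mul, hadj, mul_sub, one_mul, mul_one, sub_eq_add_neg]
  obtain ⟨A, B, hAB, hBA⟩ := exists_mul_eq_and_mul_eq_one_of_isIdempotentElem hidem
  rw [(fixedSympEquiv hchar hgp hpJ hAB hBA).finrank_eq, Module.finrank_matrix,
    Module.finrank_self, Fintype.card_fin, rank_eq_of_transpose_mul_sympJ hidem hpJ, mul_one, sq]
end
end

section
/- Let k be a field, Γ a group, and for i = 1, …, m let V_i be finite-dimensional k-vector spaces carrying representations ρ_i of Γ that are irreducible and pairwise non-isomorphic. Let B be a bilinear form on V = V_1 ⊕ ⋯ ⊕ V_m such that the summands V_i are pairwise B-orthogonal and the restriction of B to each V_i is nondegenerate. Then the only Γ-invariant subspace W of V that is totally isotropic for B (meaning B(w, w′) = 0 for all w, w′ ∈ W) is the zero subspace. -/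
noncomputable section

/-- A nonzero invariant subspace of a finite direct sum of pairwise non-isomorphic irreducible
representations contains one of the summands. -/
theorem exists_forall_single_mem_of_invariant
    {k Γ ι : Type*} [Field k] [Group Γ] [Finite ι] [DecidableEq ι]
    {V : ι → Type*} [∀ i, AddCommGroup (V i)] [∀ i, Module k (V i)]
    (ρ : ∀ i, Representation k Γ (V i))
    (hirr : ∀ i (U : Submodule k (V i)), (∀ g, ∀ x ∈ U, ρ i g x ∈ U) → U = ⊥ ∨ U = ⊤)
    (hnoniso : ∀ i j, i ≠ j →
      ¬∃ e : V i ≃ₗ[k] V j, ∀ g x, e (ρ i g x) = ρ j g (e x))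
    {W : Submodule k (∀ i, V i)}
    (hW : ∀ g, ∀ v ∈ W, (fun i => ρ i g (v i)) ∈ W) (hne : W ≠ ⊥) :
    ∃ i, ∀ x : V i, Pi.single i x ∈ W := by
  -- Choose a minimal set `S` of coordinates supporting a nonzero vector of `W`.
  obtain ⟨S, ⟨w, hwW, hw0, hwS⟩, hmin⟩ := (wellFounded_lt (α := Set ι)).has_min
    {S | ∃ w ∈ W, w ≠ 0 ∧ ∀ i ∉ S, w i = 0} (by
      obtain ⟨w, hw, hw0⟩ := W.ne_bot_iff.mp hne
      exact ⟨Set.univ, w, hw, hw0, fun i hi => absurd (Set.mem_univ i) hi⟩)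
  let WS : Submodule k (∀ i, V i) := W ⊓ Submodule.pi Sᶜ fun _ => ⊥
  have mem_WS {v : ∀ i, V i} : v ∈ WS ↔ v ∈ W ∧ ∀ i ∉ S, v i = 0 := by
    simp [WS, Submodule.mem_pi]
  have hWS (g : Γ) (v : ∀ i, V i) (hv : v ∈ WS) : (fun i => ρ i g (v i)) ∈ WS := by
    rw [mem_WS] at hv ⊢
    exact ⟨hW g v hv.1, fun i hi => by simp [hv.2 i hi]⟩
  have eq_zero {i : ι} (hi : i ∈ S) {v : ∀ i, V i} (hv : v ∈ WS) (hvi : v i = 0) : v = 0 := by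
    by_contra hv0
    refine hmin (S \ {i}) ⟨v, (mem_WS.mp hv).1, hv0, fun j hj => ?_⟩
      (Set.sdiff_singleton_ssubset.mpr hi)
    by_cases hji : j = i
    · exact hji ▸ hvi
    · exact (mem_WS.mp hv).2 j fun hjS => hj ⟨hjS, hji⟩
  let p (i : ι) : WS →ₗ[k] V i := LinearMap.proj i ∘ₗ WS.subtype
  have hp {i : ι} (hi : i ∈ S) : Function.Bijective (p i) := by
    refine ⟨(injective_iff_map_eq_zero _).mpr fun v hv => Subtype.ext (eq_zero hi v.2 hv),
      LinearMap.range_eq_top.mp ((hirr i _ ?_).resolve_left fun hbot => hw0 ?_)⟩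
    · rintro g _ ⟨v, rfl⟩
      exact ⟨⟨_, hWS g v v.2⟩, rfl⟩
    · have hwWS : w ∈ WS := mem_WS.mpr ⟨hwW, hwS⟩
      exact eq_zero hi hwWS (LinearMap.congr_fun (LinearMap.range_eq_bot.mp hbot) ⟨w, hwWS⟩)
  obtain ⟨i, hi⟩ : S.Nonempty := by
    by_contra hS
    exact hw0 (funext fun i => hwS i fun hi => hS ⟨i, hi⟩)
  have eq_of_mem (j : ι) (hj : j ∈ S) : i = j := by
    by_contra hij
    let ei := LinearEquiv.ofBijective (p i) (hp hi)
    let ej := LinearEquiv.ofBijective (p j) (hp hj)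
    refine hnoniso i j hij ⟨ei.symm.trans ej, fun g x => ?_⟩
    obtain ⟨v, rfl⟩ := ei.surjective x
    have hg : ρ i g (ei v) = ei ⟨_, hWS g v v.2⟩ := rfl
    rw [hg, LinearEquiv.trans_apply, LinearEquiv.trans_apply, ei.symm_apply_apply,
      ei.symm_apply_apply]
    rfl
  refine ⟨i, fun x => ?_⟩
  obtain ⟨v, rfl⟩ := (hp hi).2 x
  convert (mem_WS.mp v.2).1
  ext j
  by_cases hj : j = i
  · subst hj
    simp [p]
  · rw [Pi.single_eq_of_ne hj, (mem_WS.mp v.2).2 j fun hjS => hj (eq_of_mem j hjS).symm]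

/-- For a multiplicity-free direct sum of irreducible representations equipped with a bilinear
form for which the summands are pairwise orthogonal and on each of which the form is
nondegenerate, the only invariant totally isotropic subspace is zero. -/
theorem no_invariant_isotropic_subspace
    (k : Type*) [Field k] (Γ : Type*) [Group Γ] (m : ℕ)
    (V : Fin m → Type*) [∀ i, AddCommGroup (V i)] [∀ i, Module k (V i)]
    [∀ i, FiniteDimensional k (V i)] [∀ i, Nontrivial (V i)]
    (ρ : ∀ i, Representation k Γ (V i))
    (hirr : ∀ i (U : Submodule k (V i)), (∀ g, ∀ x ∈ U, ρ i g x ∈ U) → U = ⊥ ∨ U = ⊤)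
    (hnoniso : ∀ i j, i ≠ j →
      ¬∃ e : V i ≃ₗ[k] V j, ∀ g x, e (ρ i g x) = ρ j g (e x))
    (B : (∀ i, V i) →ₗ[k] (∀ i, V i) →ₗ[k] k)
    (horth : ∀ i j, i ≠ j → ∀ (x : V i) (y : V j),
      B (Pi.single i x) (Pi.single j y) = 0)
    (hnd : ∀ i (x : V i), (∀ y : V i, B (Pi.single i x) (Pi.single i y) = 0) → x = 0)
    (W : Submodule k (∀ i, V i))
    (hW : ∀ g, ∀ v ∈ W, (fun i => ρ i g (v i)) ∈ W)
    (hiso : ∀ w ∈ W, ∀ w' ∈ W, B w w' = 0) :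
    W = ⊥ := by
  by_contra hne
  obtain ⟨i, hi⟩ := exists_forall_single_mem_of_invariant ρ hirr hnoniso hW hne
  obtain ⟨x, hx⟩ := exists_ne (0 : V i)
  exact hx (hnd i x fun y => hiso _ (hi x) _ (hi y))
end
end

section
/- Let k be a field of characteristic different from 2, V a finite-dimensional k-vector space with dim V ≥ 2, and B a nondegenerate symmetric bilinear form on V. Let G be a group and ρ : G → GL(V) an irreducible representation preserving B (i.e., B(ρ(g)v, ρ(g)w) = B(v, w) for all g, v, w). Form V′ = V ⊕ k with the bilinear form B′((v,a),(w,b)) = B(v,w) + a·b, and the representation ρ′ = ρ ⊕ 1 (acting by ρ on V and trivially on k). Then: (i) every ρ′-invariant subspace of V′ that is totally isotropic for B′ is the zero subspace; and (ii) V ⊕ 0 is a ρ′-invariant subspace that is neither 0 nor V′. -/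
noncomputable section

/-- If `ρ` is an irreducible representation on `V` (with `dim V ≥ 2`, char `k ≠ 2`) preserving
a nondegenerate symmetric bilinear form `B`, then for `V′ = V ⊕ k` with the form
`B′((v,a),(w,b)) = B(v,w) + a·b` and the representation `ρ′ = ρ ⊕ 1`:
(i) the only `ρ′`-invariant totally isotropic subspace of `V′` is zero, and
(ii) `V ⊕ 0` is a `ρ′`-invariant subspace other than `0` and `V′`. -/
theorem sum_with_trivial_orthogonally_irreducible
    (k : Type*) [Field k] (hchar : (2 : k) ≠ 0)
    (V : Type*) [AddCommGroup V] [Module k V] [FiniteDimensional k V]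
    (hdim : 2 ≤ Module.finrank k V)
    (B : V →ₗ[k] V →ₗ[k] k)
    (hsymm : ∀ v w, B v w = B w v)
    (hnd : ∀ v, (∀ w, B v w = 0) → v = 0)
    (G : Type*) [Group G] (ρ : Representation k G V)
    (hB : ∀ g v w, B (ρ g v) (ρ g w) = B v w)
    (hirr : ∀ U : Submodule k V, (∀ g, ∀ x ∈ U, ρ g x ∈ U) → U = ⊥ ∨ U = ⊤) :
    (∀ W : Submodule k (V × k),
      (∀ g, ∀ p ∈ W, ((ρ g p.1, p.2) : V × k) ∈ W) →
      (∀ p ∈ W, ∀ q ∈ W, B p.1 q.1 + p.2 * q.2 = 0) →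
      W = ⊥) ∧
    ((∀ g, ∀ p ∈ (Submodule.fst k V k : Submodule k (V × k)),
        ((ρ g p.1, p.2) : V × k) ∈ (Submodule.fst k V k : Submodule k (V × k))) ∧
      (Submodule.fst k V k : Submodule k (V × k)) ≠ ⊥ ∧
      (Submodule.fst k V k : Submodule k (V × k)) ≠ ⊤) := by
  have : Nontrivial V := Module.nontrivial_of_finrank_pos (R := k) (by omega)
  obtain ⟨v₀, hv₀⟩ := exists_ne (0 : V)
  refine ⟨fun W hW hiso => ?_, ?_, ?_, ?_⟩
  · rcases hirr (W.map (LinearMap.fst k V k)) (by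
      rintro g _ ⟨p, hp, rfl⟩
      exact ⟨_, hW g p hp, rfl⟩) with hproj | hproj
    · refine (Submodule.eq_bot_iff W).2 fun p hp => ?_
      have h₁ : p.1 = 0 :=
        (Submodule.eq_bot_iff _).1 hproj p.1 (Submodule.mem_map_of_mem hp)
      have h₂ := hiso p hp p hp
      rw [h₁, map_zero, zero_add] at h₂
      exact Prod.ext h₁ (mul_self_eq_zero.1 h₂)
    · exfalso
      rcases hirr (W.comap (LinearMap.inl k V k)) (fun g x hx => hW g _ hx) with hker | hker
      · -- `W` is the graph of an invariant functional on `V`, so `ρ` is trivial.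
        have htriv : ∀ g v, ρ g v = v := fun g v => by
          obtain ⟨p, hp, rfl⟩ : v ∈ W.map (LinearMap.fst k V k) := hproj ▸ Submodule.mem_top
          refine sub_eq_zero.1 ((Submodule.eq_bot_iff _).1 hker _ ?_)
          simpa [Prod.sub_def] using W.sub_mem (hW g p hp) hp
        rcases hirr (k ∙ v₀) (fun g x hx => by rwa [htriv]) with hspan | hspan
        · exact hv₀ (Submodule.span_singleton_eq_bot.1 hspan)
        · have hone := finrank_span_singleton (K := k) hv₀
          rw [hspan, finrank_top] at hone
          omega
      · have hmem : ∀ v : V, (v, (0 : k)) ∈ W := fun v => by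
          have : v ∈ W.comap (LinearMap.inl k V k) := hker ▸ Submodule.mem_top
          exact this
        exact hv₀ (hnd v₀ fun w => by simpa using hiso _ (hmem v₀) _ (hmem w))
  · intro g p hp
    simpa [Submodule.fst] using hp
  · intro h
    have hmem : (v₀, (0 : k)) ∈ Submodule.fst k V k := by simp [Submodule.fst]
    rw [h, Submodule.mem_bot] at hmem
    exact hv₀ (congrArg Prod.fst hmem)
  · intro h
    have hmem : ((0 : V), (1 : k)) ∈ Submodule.fst k V k := h ▸ Submodule.mem_top
    simp [Submodule.fst] at hmem
end
end
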